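/- arXiv:2002.03949 — 3 statements merged into one kernel-verified Lean document; each statement's English description precedes it below -/
import Mathlib

section
/- Let H : ℝ³ → ℝ be a C^∞ function and suppose there exists c ∈ ℝ such that the superlevel set {x ∈ ℝ³ : H(x) ≥ c} is compact. Let p₀, v₀ ∈ ℝ³ with v₀ ≠ 0, H(p₀) > c, and H(p₀ + t·v₀) < H(p₀) for all t ≠ 0, and assume the function h₀(t) := H(p₀ + t·v₀) satisfies h₀'(0) = 0 and h₀''(0) < 0. Then the function G(p,v) := sup_{t ∈ ℝ} H(p + t·v) is C^∞ on some open neighbourhood of (p₀, v₀) in ℝ³ × ℝ³. -/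
open Set Filter Topology

section aux

variable {E : Type*} [NormedAddCommGroup E] [NormedSpace ℝ E]

/-- directional derivative along the line -/
noncomputable def lineD (H : E → ℝ) (w : (E × E) × ℝ) : ℝ :=
  fderiv ℝ H (w.1.1 + w.2 • w.1.2) w.1.2

/-- unique nondegenerate maximum at parameter `t` -/
def Good (H : E → ℝ) (c : ℝ) (pv : E × E) (t : ℝ) : Prop :=
  pv.2 ≠ 0 ∧ c < H (pv.1 + t • pv.2) ∧
    (∀ s : ℝ, s ≠ t → H (pv.1 + s • pv.2) < H (pv.1 + t • pv.2)) ∧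
    fderiv ℝ (lineD H) (pv, t) (0, 1) ≠ 0

lemma lineD_contDiff {H : E → ℝ} (hH : ContDiff ℝ (⊤ : ℕ∞) H) :
    ContDiff ℝ (⊤ : ℕ∞) (lineD H) := by
  have h1 : ContDiff ℝ (⊤ : ℕ∞) (fderiv ℝ H) := hH.fderiv_right (by simp)
  unfold lineD
  exact (h1.comp (by fun_prop)).clm_apply (by fun_prop)

lemma line_hasDerivAt {H : E → ℝ} (hH : ContDiff ℝ (⊤ : ℕ∞) H) (p v : E) (t : ℝ) :
    HasDerivAt (fun s : ℝ => H (p + s • v)) (lineD H ((p, v), t)) t := by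
  have h1 : HasDerivAt (fun s : ℝ => p + s • v) v t := by
    simpa using ((hasDerivAt_id t).smul_const v).const_add p
  exact ((hH.differentiable (by simp)) (p + t • v)).hasFDerivAt.comp_hasDerivAt t h1

lemma lineD_hasDerivAt {H : E → ℝ} (hH : ContDiff ℝ (⊤ : ℕ∞) H) (p v : E) (t : ℝ) :
    HasDerivAt (fun s : ℝ => lineD H ((p, v), s))
      (fderiv ℝ (lineD H) ((p, v), t) (0, 1)) t := by
  have h1 : HasDerivAt (fun s : ℝ => ((p, v), s)) ((0 : E × E), (1 : ℝ)) t :=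
    (hasDerivAt_const t (p, v)).prodMk (hasDerivAt_id t)
  exact (((lineD_contDiff hH).differentiable (by simp)) ((p, v), t)).hasFDerivAt.comp_hasDerivAt t h1

/-- far from the maximizer, the values are smaller, uniformly near `pv` -/
lemma far_lt {H : E → ℝ} (hH : Continuous H) {c : ℝ}
    (hK : IsCompact {x : E | c ≤ H x}) {pv : E × E} {t : ℝ} (hg : Good H c pv t)
    {δ : ℝ} (hδ : 0 < δ) :
    ∀ᶠ q : E × E in 𝓝 pv, c < H (q.1 + t • q.2) ∧
      ∀ s : ℝ, δ ≤ |s - t| → H (q.1 + s • q.2) < H (q.1 + t • q.2) := by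
  obtain ⟨hv, hc, hm, -⟩ := hg
  obtain ⟨M, hM⟩ := hK.isBounded.exists_norm_le
  have hvp : 0 < ‖pv.2‖ := norm_pos_iff.2 hv
  set R : ℝ := (M + ‖pv.1‖ + 1) / (‖pv.2‖ / 2) with hR
  have e1 : ∀ᶠ q : E × E in 𝓝 pv, c < H (q.1 + t • q.2) :=
    (show Continuous fun q : E × E => H (q.1 + t • q.2) by fun_prop).continuousAt.eventually
      (lt_mem_nhds hc)
  have e2 : ∀ᶠ q : E × E in 𝓝 pv, ‖q.1‖ < ‖pv.1‖ + 1 :=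
    (show Continuous fun q : E × E => ‖q.1‖ by fun_prop).continuousAt.eventually
      (gt_mem_nhds (by simp))
  have e3 : ∀ᶠ q : E × E in 𝓝 pv, ‖pv.2‖ / 2 < ‖q.2‖ :=
    (show Continuous fun q : E × E => ‖q.2‖ by fun_prop).continuousAt.eventually
      (lt_mem_nhds (by simpa using hvp))
  have hC : IsCompact (Icc (-R) R ∩ {s : ℝ | δ ≤ |s - t|}) :=
    isCompact_Icc.inter_right (isClosed_le (by fun_prop) (by fun_prop))
  have e4 : ∀ᶠ q : E × E in 𝓝 pv, ∀ s ∈ Icc (-R) R ∩ {s : ℝ | δ ≤ |s - t|},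
      H (q.1 + s • q.2) < H (q.1 + t • q.2) := by
    apply hC.eventually_forall_of_forall_eventually
    intro s hs
    have hne : s ≠ t := by
      rintro rfl
      have := hs.2
      simp at this
      linarith
    have hcont : Continuous fun z : (E × E) × ℝ =>
        H (z.1.1 + t • z.1.2) - H (z.1.1 + z.2 • z.1.2) := by fun_prop
    have := (hcont.continuousAt (x := (pv, s))).eventually
      (lt_mem_nhds (a := 0) (sub_pos.2 (hm s hne)))
    filter_upwards [this] with z hz
    exact sub_pos.1 hz
  filter_upwards [e1, e2, e3, e4] with q h1 h2 h3 h4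
  refine ⟨h1, fun s hs => ?_⟩
  by_cases hsR : s ∈ Icc (-R) R
  · exact h4 s ⟨hsR, hs⟩
  · by_contra hcon
    have hmem : c ≤ H (q.1 + s • q.2) := h1.le.trans (not_lt.1 hcon)
    have hb := hM _ hmem
    apply hsR
    rw [mem_Icc, ← abs_le, hR, le_div_iff₀ (by positivity)]
    have : ‖s • q.2‖ ≤ ‖q.1 + s • q.2‖ + ‖q.1‖ := by
      simpa using norm_sub_le (q.1 + s • q.2) q.1
    rw [norm_smul, Real.norm_eq_abs] at this
    have := mul_le_mul_of_nonneg_left h3.le (abs_nonneg s)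
    linarith

lemma good_main [CompleteSpace E] {H : E → ℝ} (hH : ContDiff ℝ (⊤ : ℕ∞) H) {c : ℝ}
    (hK : IsCompact {x : E | c ≤ H x}) {pv : E × E} {t : ℝ} (hg : Good H c pv t) :
    ContDiffAt ℝ (⊤ : ℕ∞) (fun q : E × E => ⨆ s : ℝ, H (q.1 + s • q.2)) pv ∧
      ∀ᶠ q in 𝓝 pv, ∃ s, Good H c q s := by
  have hHc := hH.continuous
  have hF := lineD_contDiff hH
  have cdf : ContDiffAt ℝ (⊤ : ℕ∞) (lineD H) (pv, t) := hF.contDiffAt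
  have pn : ((⊤ : ℕ∞) : WithTop ℕ∞) ≠ 0 := by simp
  have inv : (fderiv ℝ (lineD H) (pv, t) ∘L .inr ℝ (E × E) ℝ).IsInvertible := by
    refine ⟨ContinuousLinearEquiv.unitsEquivAut ℝ (Units.mk0 _ hg.2.2.2), ?_⟩
    ext
    simp
  have hz : ∀ (q : E × E) (s : ℝ), (∀ r : ℝ, H (q.1 + r • q.2) ≤ H (q.1 + s • q.2)) →
      lineD H (q, s) = 0 := by
    intro q s h
    exact IsLocalMax.hasDerivAt_eq_zero (f := fun r : ℝ => H (q.1 + r • q.2))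
      (Eventually.of_forall h) (line_hasDerivAt hH q.1 q.2 s)
  have h0 : lineD H (pv, t) = 0 := by
    apply hz
    intro r
    by_cases h : r = t
    · rw [h]
    · exact (hg.2.2.1 r h).le
  set ψ := cdf.implicitFunction pn inv with hψ
  have hψs : ContDiffAt ℝ (⊤ : ℕ∞) ψ pv := cdf.contDiffAt_implicitFunction pn inv
  have hψ0 : ψ pv = t := cdf.implicitFunction_apply_self pn inv
  have hiff := cdf.eventually_apply_eq_iff_implicitFunction pn inv
  rw [h0, ← hψ, nhds_prod_eq, eventually_prod_iff] at hiff
  obtain ⟨P, hP, Q, hQ, hPQ⟩ := hiff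
  obtain ⟨ε, hε, hεQ⟩ := Metric.eventually_nhds_iff.1 hQ
  have key : ∀ᶠ q in 𝓝 pv, c < H (q.1 + ψ q • q.2) ∧
      ∀ s : ℝ, s ≠ ψ q → H (q.1 + s • q.2) < H (q.1 + ψ q • q.2) := by
    filter_upwards [hP, far_lt hHc hK hg (half_pos hε)] with q hq ⟨hc, hfar⟩
    have uniq : ∀ s : ℝ, (∀ r : ℝ, H (q.1 + r • q.2) ≤ H (q.1 + s • q.2)) → ψ q = s := by
      intro s hs
      have hnear : |s - t| < ε / 2 := by
        by_contra hcon
        exact absurd (hfar s (not_lt.1 hcon)) (not_lt.2 (hs t))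
      exact (hPQ hq (hεQ (by rw [Real.dist_eq]; linarith))).1 (hz q s hs)
    obtain ⟨s, hs, hsm⟩ := (isCompact_Icc (a := t - ε / 2) (b := t + ε / 2)).exists_isMaxOn
      ⟨t, by constructor <;> linarith⟩
      (show Continuous fun r : ℝ => H (q.1 + r • q.2) by fun_prop).continuousOn
    have hst : H (q.1 + t • q.2) ≤ H (q.1 + s • q.2) :=
      hsm (show t ∈ Icc _ _ by constructor <;> linarith)
    have hglob : ∀ r : ℝ, H (q.1 + r • q.2) ≤ H (q.1 + s • q.2) := by
      intro r
      by_cases hr : ε / 2 ≤ |r - t|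
      · exact (hfar r hr).le.trans hst
      · rw [not_le, abs_lt] at hr
        exact hsm (show r ∈ Icc _ _ by constructor <;> linarith)
    have hs' := uniq s hglob
    rw [hs']
    refine ⟨hc.trans_le hst, fun r hr => lt_of_le_of_ne (hglob r) fun he => hr ?_⟩
    rw [← hs', uniq r (fun x => he ▸ hglob x)]
  constructor
  · have : ContDiffAt ℝ (⊤ : ℕ∞) (fun q : E × E => H (q.1 + ψ q • q.2)) pv :=
      hH.contDiffAt.comp pv (by fun_prop)
    refine this.congr_of_eventuallyEq ?_
    filter_upwards [key] with q hq
    have hle : ∀ r : ℝ, H (q.1 + r • q.2) ≤ H (q.1 + ψ q • q.2) := fun r => by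
      by_cases h : r = ψ q
      · rw [h]
      · exact (hq.2 r h).le
    exact le_antisymm (ciSup_le hle)
      (le_ciSup (f := fun r : ℝ => H (q.1 + r • q.2)) ⟨_, by rintro _ ⟨r, rfl⟩; exact hle r⟩ (ψ q))
  · have e1 : ∀ᶠ q : E × E in 𝓝 pv, q.2 ≠ 0 :=
      continuous_snd.continuousAt.eventually_ne hg.1
    have e2 : ∀ᶠ q : E × E in 𝓝 pv, fderiv ℝ (lineD H) (q, ψ q) (0, 1) ≠ 0 := by
      have hc1 : Continuous fun w => fderiv ℝ (lineD H) w (0, 1) :=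
        (hF.continuous_fderiv (by simp)).clm_apply continuous_const
      have hc2 : ContinuousAt (fun q : E × E => (q, ψ q)) pv :=
        continuousAt_id.prodMk hψs.continuousAt
      have hc3 : ContinuousAt (fun q : E × E => fderiv ℝ (lineD H) (q, ψ q) (0, 1)) pv :=
        ContinuousAt.comp (f := fun q : E × E => (q, ψ q)) hc1.continuousAt hc2
      exact hc3.eventually_ne (by rw [hψ0]; exact hg.2.2.2)
    filter_upwards [key, e1, e2] with q h1 h2 h3
    exact ⟨ψ q, h2, h1.1, h1.2, h3⟩

end aux

/-- Let `H : ℝ³ → ℝ` be `C^∞` with a compact superlevel set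
`{H ≥ c}`. Let `p₀, v₀ ∈ ℝ³` with `v₀ ≠ 0`, `H(p₀) > c`, `H(p₀ + t·v₀) < H(p₀)` for all
`t ≠ 0`, and assume `h₀(t) := H(p₀ + t·v₀)` satisfies `h₀'(0) = 0` and `h₀''(0) < 0`.
Then `G(p,v) := sup_{t ∈ ℝ} H(p + t·v)` is `C^∞` on some open neighbourhood of
`(p₀, v₀)`. -/
theorem stmt_8 (H : ℝ × ℝ × ℝ → ℝ) (hH : ContDiff ℝ (⊤ : ℕ∞) H) (c : ℝ)
    (hcompact : IsCompact {x : ℝ × ℝ × ℝ | c ≤ H x})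
    (p₀ v₀ : ℝ × ℝ × ℝ) (hv₀ : v₀ ≠ 0) (hc : c < H p₀)
    (hmax : ∀ t : ℝ, t ≠ 0 → H (p₀ + t • v₀) < H p₀)
    (hcrit : deriv (fun t : ℝ => H (p₀ + t • v₀)) 0 = 0)
    (hnondeg : deriv (deriv (fun t : ℝ => H (p₀ + t • v₀))) 0 < 0) :
    ∃ W : Set ((ℝ × ℝ × ℝ) × (ℝ × ℝ × ℝ)), IsOpen W ∧ (p₀, v₀) ∈ W ∧
      ContDiffOn ℝ (⊤ : ℕ∞)
        (fun pv : (ℝ × ℝ × ℝ) × (ℝ × ℝ × ℝ) => ⨆ t : ℝ, H (pv.1 + t • pv.2)) W := by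

  refine ⟨{pv | ∃ t, Good H c pv t}, ?_, ⟨0, hv₀, by simpa using hc, ?_, ?_⟩, ?_⟩
  · rw [isOpen_iff_mem_nhds]
    rintro pv ⟨t, ht⟩
    exact (good_main hH hcompact ht).2
  · intro s hs
    simpa using hmax s hs
  · have h1 : deriv (fun t : ℝ => H (p₀ + t • v₀)) = fun t => lineD H ((p₀, v₀), t) :=
      funext fun t => (line_hasDerivAt hH p₀ v₀ t).deriv
    rw [h1, (lineD_hasDerivAt hH p₀ v₀ 0).deriv] at hnondeg
    exact hnondeg.ne
  · rintro pv ⟨t, ht⟩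
    exact (good_main hH hcompact ht).1.contDiffWithinAt
end

section
/- Let H : ℝ³ → ℝ be a C^∞ function and suppose there exists c ∈ ℝ such that the superlevel set {x ∈ ℝ³ : H(x) ≥ c} is compact. Let p₀, v₀ ∈ ℝ³ with v₀ ≠ 0, H(p₀) > c, and H(p₀ + t·v₀) < H(p₀) for all t ≠ 0, and assume the function h₀(t) := H(p₀ + t·v₀) satisfies h₀'(0) = 0 and h₀''(0) < 0. Then the function G(p,v) := sup_{t ∈ ℝ} H(p + t·v) is Fréchet differentiable at (p₀, v₀) and its derivative is the linear map (w,u) ↦ DH(p₀)(w). In particular, if DH(p₀) ≠ 0 then DG(p₀,v₀) ≠ 0. -/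
open Filter Topology in
theorem danskin_far {E : Type*} [NormedAddCommGroup E] [NormedSpace ℝ E]
    (H : E → ℝ) (hH : Continuous H) (c : ℝ)
    (hcompact : IsCompact {x : E | c ≤ H x})
    (p₀ v₀ : E) (hv₀ : v₀ ≠ 0) (hc : c < H p₀)
    (hmax : ∀ t : ℝ, t ≠ 0 → H (p₀ + t • v₀) < H p₀) (δ : ℝ) (hδ : 0 < δ) :
    ∀ᶠ pv : E × E in 𝓝 (p₀, v₀), ∀ t : ℝ, δ ≤ |t| → H (pv.1 + t • pv.2) ≤ H pv.1 := by
  obtain ⟨R, hR⟩ := hcompact.isBounded.exists_norm_le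
  have hv : 0 < ‖v₀‖ := norm_pos_iff.mpr hv₀
  set T : ℝ := (|R| + ‖p₀‖ + 1) / (‖v₀‖ / 2) with hT
  have hS : IsCompact (Metric.closedBall (0 : ℝ) T ∩ {t : ℝ | δ ≤ |t|}) :=
    (isCompact_closedBall 0 T).inter_right (isClosed_le continuous_const continuous_abs)
  have h1 : ∀ᶠ pv : E × E in 𝓝 (p₀, v₀),
      ∀ t ∈ (Metric.closedBall (0 : ℝ) T ∩ {t : ℝ | δ ≤ |t|}),
        H (pv.1 + t • pv.2) < H pv.1 := by
    apply hS.eventually_forall_of_forall_eventually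
    intro t ht
    have hopen : IsOpen {z : (E × E) × ℝ | H (z.1.1 + z.2 • z.1.2) < H z.1.1} :=
      isOpen_lt (by fun_prop) (by fun_prop)
    refine hopen.mem_nhds ?_
    refine hmax t ?_
    rintro rfl
    have := ht.2
    simp at this
    linarith
  have h2 : ∀ᶠ pv : E × E in 𝓝 (p₀, v₀), c < H pv.1 :=
    (isOpen_lt (f := fun _ : E × E => c) (g := fun z : E × E => H z.1)
      (by fun_prop) (by fun_prop)).mem_nhds hc
  have h3 : ∀ᶠ pv : E × E in 𝓝 (p₀, v₀), ‖pv.1‖ < ‖p₀‖ + 1 :=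
    (isOpen_lt (f := fun z : E × E => ‖z.1‖) (g := fun _ : E × E => ‖p₀‖ + 1)
      (by fun_prop) (by fun_prop)).mem_nhds (by simp)
  have h4 : ∀ᶠ pv : E × E in 𝓝 (p₀, v₀), ‖v₀‖ / 2 < ‖pv.2‖ :=
    (isOpen_lt (f := fun _ : E × E => ‖v₀‖ / 2) (g := fun z : E × E => ‖z.2‖)
      (by fun_prop) (by fun_prop)).mem_nhds (half_lt_self hv)
  filter_upwards [h1, h2, h3, h4] with pv h1 h2 h3 h4 t ht
  by_cases htT : |t| ≤ T
  · exact (h1 t ⟨by simpa using htT, ht⟩).le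
  · push Not at htT
    by_contra! hlt
    have hb := hR (pv.1 + t • pv.2) (by simp only [Set.mem_ofPred_eq]; linarith)
    have e1 : |t| * ‖pv.2‖ ≤ ‖pv.1 + t • pv.2‖ + ‖pv.1‖ := by
      have := norm_sub_le (pv.1 + t • pv.2) pv.1
      rwa [add_sub_cancel_left, norm_smul, Real.norm_eq_abs] at this
    have e2 : |R| + ‖p₀‖ + 1 < |t| * (‖v₀‖ / 2) := by
      rwa [hT, div_lt_iff₀ (by linarith)] at htT
    have e3 : |t| * (‖v₀‖ / 2) ≤ |t| * ‖pv.2‖ := by gcongr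
    have := le_abs_self R
    linarith

open Filter Topology in
theorem danskin {E : Type*} [NormedAddCommGroup E] [NormedSpace ℝ E]
    (H : E → ℝ) (hH : ContDiff ℝ (⊤ : ℕ∞) H) (c : ℝ)
    (hcompact : IsCompact {x : E | c ≤ H x})
    (p₀ v₀ : E) (hv₀ : v₀ ≠ 0) (hc : c < H p₀)
    (hmax : ∀ t : ℝ, t ≠ 0 → H (p₀ + t • v₀) < H p₀) :
    HasFDerivAt (fun pv : E × E => ⨆ t : ℝ, H (pv.1 + t • pv.2))
        ((fderiv ℝ H p₀).comp (ContinuousLinearMap.fst ℝ E E)) (p₀, v₀) := by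
  have hbdd : ∀ pv : E × E, BddAbove (Set.range fun t : ℝ => H (pv.1 + t • pv.2)) := by
    intro pv
    obtain ⟨M, hM⟩ := hcompact.bddAbove_image hH.continuous.continuousOn
    refine ⟨max M c, ?_⟩
    rintro _ ⟨t, rfl⟩
    by_cases h : c ≤ H (pv.1 + t • pv.2)
    · exact le_max_of_le_left (hM ⟨_, h, rfl⟩)
    · exact le_max_of_le_right (not_le.mp h).le
  have hG0 : (⨆ t : ℝ, H (p₀ + t • v₀)) = H p₀ := by
    apply le_antisymm
    · apply ciSup_le
      intro t
      by_cases h : t = 0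
      · simp [h]
      · exact (hmax t h).le
    · simpa using le_ciSup (hbdd (p₀, v₀)) 0
  have hstrict : HasStrictFDerivAt H (fderiv ℝ H p₀) p₀ :=
    hH.contDiffAt.hasStrictFDerivAt (by simp)
  set D := fderiv ℝ H p₀ with hD
  apply HasFDerivAt.of_isLittleO
  rw [Asymptotics.isLittleO_iff]
  intro ε hε
  have hs := (Asymptotics.isLittleO_iff.mp hstrict.isLittleO) (c := ε / 4) (by linarith)
  have hnear : ∀ᶠ z : (E × E) × ℝ in 𝓝 ((p₀, v₀), (0 : ℝ)),
      ‖H (z.1.1 + z.2 • z.1.2) - H (p₀ + z.2 • v₀)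
        - D ((z.1.1 + z.2 • z.1.2) - (p₀ + z.2 • v₀))‖
      ≤ ε / 4 * ‖(z.1.1 + z.2 • z.1.2) - (p₀ + z.2 • v₀)‖ := by
    have hcont : Continuous fun z : (E × E) × ℝ =>
        ((z.1.1 + z.2 • z.1.2, p₀ + z.2 • v₀) : E × E) := by fun_prop
    have ht := hcont.tendsto ((p₀, v₀), (0 : ℝ))
    simp only [zero_smul, add_zero] at ht
    exact ht.eventually hs
  rw [nhds_prod_eq, eventually_prod_iff] at hnear
  obtain ⟨pa, hpa, pb, hpb, hab⟩ := hnear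
  obtain ⟨δ₁, hδ₁, hball⟩ := Metric.eventually_nhds_iff.mp hpb
  set δ := min δ₁ (min 1 (ε / (4 * (‖D‖ + 1)))) with hδdef
  have hδ : 0 < δ := by positivity
  have hpb0 : pb 0 := hball (by simpa using hδ₁)
  filter_upwards [hpa, danskin_far H hH.continuous c hcompact p₀ v₀ hv₀ hc hmax δ hδ]
    with pv hpv hfar
  have hn1 : ‖pv.1 - p₀‖ ≤ ‖pv - (p₀, v₀)‖ := norm_fst_le (pv - (p₀, v₀))
  have hn2 : ‖pv.2 - v₀‖ ≤ ‖pv - (p₀, v₀)‖ := norm_snd_le (pv - (p₀, v₀))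
  have hN : 0 ≤ ‖pv - (p₀, v₀)‖ := norm_nonneg _
  set N := ‖pv - (p₀, v₀)‖ with hNdef
  have hp : ‖H pv.1 - H p₀ - D (pv.1 - p₀)‖ ≤ ε / 4 * ‖pv.1 - p₀‖ := by
    simpa using hab hpv hpb0
  have hp' := (Real.norm_eq_abs _ ▸ hp)
  rw [abs_le] at hp'
  have hεN : ε / 4 * ‖pv.1 - p₀‖ ≤ ε / 4 * N := by gcongr
  have hεN' : 0 ≤ ε * N := by positivity
  have hupper : ∀ t : ℝ, H (pv.1 + t • pv.2) ≤ H p₀ + D (pv.1 - p₀) + ε * N := by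
    intro t
    by_cases htδ : δ ≤ |t|
    · have := hfar t htδ
      linarith [hp'.2]
    · push Not at htδ
      have htb : pb t := hball (by
        simpa using lt_of_lt_of_le htδ (min_le_left _ _))
      have ht1 : |t| ≤ 1 :=
        htδ.le.trans ((min_le_right _ _).trans (min_le_left _ _))
      have ht2 : |t| ≤ ε / (4 * (‖D‖ + 1)) :=
        htδ.le.trans ((min_le_right _ _).trans (min_le_right _ _))
      have hh := hab hpv htb
      simp only at hh
      have hxy : (pv.1 + t • pv.2) - (p₀ + t • v₀) = (pv.1 - p₀) + t • (pv.2 - v₀) := by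
        module
      rw [hxy, Real.norm_eq_abs, map_add, map_smul, smul_eq_mul] at hh
      have h5 : ‖(pv.1 - p₀) + t • (pv.2 - v₀)‖ ≤ N + 1 * N := by
        refine (norm_add_le _ _).trans ?_
        rw [norm_smul, Real.norm_eq_abs]
        gcongr
      have h6 : ε / 4 * ‖(pv.1 - p₀) + t • (pv.2 - v₀)‖ ≤ ε / 4 * (N + 1 * N) := by gcongr
      have h7 : t * D (pv.2 - v₀) ≤ ε / 4 * N := by
        calc t * D (pv.2 - v₀) ≤ |t * D (pv.2 - v₀)| := le_abs_self _
          _ = |t| * ‖D (pv.2 - v₀)‖ := by rw [abs_mul, Real.norm_eq_abs]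
          _ ≤ (ε / (4 * (‖D‖ + 1))) * ((‖D‖ + 1) * N) := by
              gcongr
              refine (D.le_opNorm _).trans ?_
              gcongr
              linarith
          _ = ε / 4 * N := by
              have : ‖D‖ + 1 ≠ 0 := by positivity
              field_simp
      have h8 : H (p₀ + t • v₀) ≤ H p₀ := by
        rw [← hG0]; exact le_ciSup (hbdd (p₀, v₀)) t
      have h9 := (abs_le.mp hh).2
      linarith
  have hU := ciSup_le hupper
  have hL : H pv.1 ≤ ⨆ t : ℝ, H (pv.1 + t • pv.2) := by
    simpa using le_ciSup (hbdd pv) 0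
  have hval : ((D.comp (ContinuousLinearMap.fst ℝ E E)) (pv - (p₀, v₀))) = D (pv.1 - p₀) := rfl
  rw [hval, hG0, Real.norm_eq_abs, abs_le]
  constructor <;> linarith [hp'.1]


/-- With hypotheses as in Statement 8, the function
`G(p,v) := sup_{t ∈ ℝ} H(p + t·v)` is Fréchet differentiable at `(p₀, v₀)` and its
derivative is the linear map `(w,u) ↦ DH(p₀)(w)`. In particular, if `DH(p₀) ≠ 0` then
`DG(p₀,v₀) ≠ 0`. -/
theorem stmt_9 (H : ℝ × ℝ × ℝ → ℝ) (hH : ContDiff ℝ (⊤ : ℕ∞) H) (c : ℝ)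
    (hcompact : IsCompact {x : ℝ × ℝ × ℝ | c ≤ H x})
    (p₀ v₀ : ℝ × ℝ × ℝ) (hv₀ : v₀ ≠ 0) (hc : c < H p₀)
    (hmax : ∀ t : ℝ, t ≠ 0 → H (p₀ + t • v₀) < H p₀)
    (hcrit : deriv (fun t : ℝ => H (p₀ + t • v₀)) 0 = 0)
    (hnondeg : deriv (deriv (fun t : ℝ => H (p₀ + t • v₀))) 0 < 0) :
    HasFDerivAt (fun pv : (ℝ × ℝ × ℝ) × (ℝ × ℝ × ℝ) => ⨆ t : ℝ, H (pv.1 + t • pv.2))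
        ((fderiv ℝ H p₀).comp (ContinuousLinearMap.fst ℝ (ℝ × ℝ × ℝ) (ℝ × ℝ × ℝ)))
        (p₀, v₀) ∧
      (fderiv ℝ H p₀ ≠ 0 →
        fderiv ℝ (fun pv : (ℝ × ℝ × ℝ) × (ℝ × ℝ × ℝ) => ⨆ t : ℝ, H (pv.1 + t • pv.2))
          (p₀, v₀) ≠ 0) := by
  have h := danskin H hH c hcompact p₀ v₀ hv₀ hc hmax
  refine ⟨h, fun hne h0 => hne ?_⟩
  rw [h.fderiv] at h0
  refine ContinuousLinearMap.ext fun w => ?_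
  exact congrArg (fun L => L (w, (0 : ℝ × ℝ × ℝ))) h0
end

section
/- Let η be the Minkowski bilinear form on ℝ³, η(v,w) = −v₀w₀ + v₁w₁ + v₂w₂. Let f : ℝ → ℝ be continuously differentiable on [−1,1] with f(t) < 0 and f'(t)² < 1 for all t ∈ [−1,1]. Let θ : ℝ → ℝ be differentiable with θ'(t) > 0 for all t ∈ [−1,1], and suppose the curve Γ(s) = (s, −f(s)·cos θ(s), −f(s)·sin θ(s)) satisfies η(Γ'(t), Γ'(t)) = 0 for all t ∈ [−1,1]. Then θ(1) − θ(−1) = ∫_{−1}^{1} √(1 − f'(t)²) / (−f(t)) dt. -/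
/-- The Minkowski bilinear form on `ℝ³`: `η(v,w) = −v₀w₀ + v₁w₁ + v₂w₂`. -/
def minkowski (v w : ℝ × ℝ × ℝ) : ℝ :=
  -(v.1 * w.1) + v.2.1 * w.2.1 + v.2.2 * w.2.2

/-- Let `f : ℝ → ℝ` be continuously differentiable on `[−1,1]` with
`f(t) < 0` and `f'(t)² < 1` for all `t ∈ [−1,1]`. Let `θ : ℝ → ℝ` be differentiable with
`θ'(t) > 0` for all `t ∈ [−1,1]`, and suppose the curve
`Γ(s) = (s, −f(s)·cos θ(s), −f(s)·sin θ(s))` satisfies `η(Γ'(t), Γ'(t)) = 0` for all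
`t ∈ [−1,1]`. Then `θ(1) − θ(−1) = ∫_{−1}^{1} √(1 − f'(t)²) / (−f(t)) dt`. -/
theorem stmt_14 (f f' θ θ' : ℝ → ℝ)
    (hf : ∀ t ∈ Set.Icc (-1 : ℝ) 1, HasDerivAt f (f' t) t)
    (hf'c : ContinuousOn f' (Set.Icc (-1 : ℝ) 1))
    (hfneg : ∀ t ∈ Set.Icc (-1 : ℝ) 1, f t < 0)
    (hf'lt : ∀ t ∈ Set.Icc (-1 : ℝ) 1, (f' t) ^ 2 < 1)
    (hθ : ∀ t ∈ Set.Icc (-1 : ℝ) 1, HasDerivAt θ (θ' t) t)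
    (hθ'pos : ∀ t ∈ Set.Icc (-1 : ℝ) 1, 0 < θ' t)
    (hnull : ∀ t ∈ Set.Icc (-1 : ℝ) 1,
      minkowski
        (deriv (fun s : ℝ =>
          ((s, -f s * Real.cos (θ s), -f s * Real.sin (θ s)) : ℝ × ℝ × ℝ)) t)
        (deriv (fun s : ℝ =>
          ((s, -f s * Real.cos (θ s), -f s * Real.sin (θ s)) : ℝ × ℝ × ℝ)) t) = 0) :
    θ 1 - θ (-1) = ∫ t in (-1 : ℝ)..1, Real.sqrt (1 - (f' t) ^ 2) / (-f t) := by
  have key : ∀ t ∈ Set.Icc (-1 : ℝ) 1, θ' t = Real.sqrt (1 - (f' t) ^ 2) / (-f t) := by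
    intro t ht
    have h1 := (hf t ht).neg.mul (hθ t ht).cos
    have h2 := (hf t ht).neg.mul (hθ t ht).sin
    have h3 : HasDerivAt (fun s : ℝ =>
          ((s, -f s * Real.cos (θ s), -f s * Real.sin (θ s)) : ℝ × ℝ × ℝ)) _ t :=
      (hasDerivAt_id t).prodMk (h1.prodMk h2)
    have h := hnull t ht
    rw [h3.deriv] at h
    simp only [minkowski, Pi.neg_apply] at h
    have hn := hfneg t ht
    have hp := hθ'pos t ht
    have hsc := Real.sin_sq_add_cos_sq (θ t)
    have e : 1 - (f' t) ^ 2 = (θ' t * (-f t)) ^ 2 := by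
      linear_combination (-1 : ℝ) * h + ((f' t) ^ 2 + (θ' t * f t) ^ 2) * hsc
    rw [e, Real.sqrt_sq (mul_nonneg hp.le (by linarith))]
    rw [mul_div_cancel_right₀ _ (neg_ne_zero.mpr hn.ne)]
  have hu : Set.uIcc (-1 : ℝ) 1 = Set.Icc (-1 : ℝ) 1 := Set.uIcc_of_le (by norm_num)
  have hfc : ContinuousOn f (Set.Icc (-1 : ℝ) 1) :=
    fun t ht => (hf t ht).continuousAt.continuousWithinAt
  have hc : ContinuousOn (fun t => Real.sqrt (1 - (f' t) ^ 2) / (-f t)) (Set.uIcc (-1 : ℝ) 1) := by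
    rw [hu]
    refine ContinuousOn.div ?_ hfc.neg (fun t ht => ?_)
    · exact (continuousOn_const.sub (hf'c.pow 2)).sqrt
    · have := hfneg t ht
      linarith
  refine (intervalIntegral.integral_eq_sub_of_hasDerivAt (fun t ht => ?_) hc.intervalIntegrable).symm
  rw [hu] at ht
  rw [← key t ht]
  exact hθ t ht
end
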